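/- arXiv:1706.02617 — 11 statements merged into one kernel-verified Lean document; each statement's English description precedes it below -/
import Mathlib

section
/- Suppose real sequences (a_n)_{n≥0}, (b_n)_{n≥0}, (c_n)_{n≥1} satisfy b_0 + a_0 = 1 and a_n + b_n + c_n = 1 for n ≥ 1, and real sequences (x_n)_{n≥0}, (y_n)_{n≥0}, (s_n)_{n≥0}, (r_n)_{n≥1} with s_0 = 1 and x_n > 0 for all n ≥ 0 satisfy the UL relations a_n = x_n s_{n+1} and b_n = x_n r_{n+1} + y_n s_n for n ≥ 0, and c_n = y_n r_n for n ≥ 1. Then x_n + y_n = 1 for all n ≥ 0 if and only if s_n + r_n = 1 for all n ≥ 1. -/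
/-- Lemma 2.1 (UL case): in a UL factorization of a tridiagonal stochastic matrix,
the upper factor is stochastic iff the lower factor is stochastic. -/
theorem stochastic_UL_iff (a b c x y s r : ℕ → ℝ)
    (hrow0 : b 0 + a 0 = 1)
    (hrow : ∀ n ≥ 1, a n + b n + c n = 1)
    (hs0 : s 0 = 1)
    (hxpos : ∀ n, x n > 0)
    (hULa : ∀ n, a n = x n * s (n + 1))
    (hULb : ∀ n, b n = x n * r (n + 1) + y n * s n)
    (hULc : ∀ n ≥ 1, c n = y n * r n) :
    (∀ n, x n + y n = 1) ↔ (∀ n ≥ 1, s n + r n = 1) := by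
  have h0 : x 0 * (s 1 + r 1) + y 0 = 1 := by
    have ha := hULa 0
    have hb := hULb 0
    rw [hs0] at hb
    simp only [zero_add] at ha hb
    linarith
  have h1 : ∀ n ≥ 1, x n * (s (n + 1) + r (n + 1)) + y n * (s n + r n) = 1 := by
    intro n hn
    linarith [hULa n, hULb n, hULc n hn, hrow n hn]
  constructor
  · intro h n hn
    induction n, hn using Nat.le_induction with
    | base =>
      apply mul_left_cancel₀ (hxpos 0).ne'
      linarith [h 0]
    | succ k hk ih =>
      have e := h1 k hk
      rw [ih] at e
      apply mul_left_cancel₀ (hxpos k).ne'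
      linarith [h k]
  · intro h n
    rcases Nat.eq_zero_or_pos n with rfl | hn
    · rw [h 1 le_rfl] at h0
      linarith
    · have e := h1 n hn
      rw [h n hn, h (n + 1) (by omega)] at e
      linarith
end

section
/- Let (a_n)_{n≥0} and (c_n)_{n≥1} be real sequences with 0 < a_n < 1 and 0 < c_{n+1} < 1 for all n ≥ 0. Let ξ_{2n+1} = a_n (n ≥ 0) and ξ_{2n} = c_n (n ≥ 1), and define the convergents h_n = A_n/B_n by A_{-1} = 1, A_0 = 1, B_{-1} = 0, B_0 = 1, A_n = A_{n-1} - ξ_n A_{n-2}, B_n = B_{n-1} - ξ_n B_{n-2}. Assume 0 < A_n < B_n for all n ≥ 1, and let H = lim_{n→∞} A_n/B_n. Fix y_0 ∈ ℝ. Then there exist real sequences (y_n)_{n≥0} and (s_n)_{n≥1} with s_{n+1}(1 - y_n) = a_n and y_{n+1}(1 - s_{n+1}) = c_{n+1} for all n ≥ 0, satisfying 0 ≤ y_0 < 1, 0 < y_n < 1 for all n ≥ 1 and 0 < s_n < 1 for all n ≥ 1, if and only if 0 ≤ y_0 ≤ H. -/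
/-- Proposition 2.5: the stochastic UL factorization of an irreducible random walk on the
nonnegative integers, with up probabilities `a n` and down probabilities `c n`, exists
exactly when the free parameter `y₀` lies in `[0, H]`, where `H` is the limit of the
convergents `Aₙ/Bₙ` (written `A (n+1) / B (n+1)` here) of the continued fraction
`1 - a₀/(1 - c₁/(1 - a₁/(1 - ⋯)))`. -/
theorem stochastic_UL_exists_iff (a c : ℕ → ℝ)
    (ha : ∀ n, 0 < a n ∧ a n < 1)
    (hc : ∀ n ≥ 1, 0 < c n ∧ c n < 1)
    (ξ A B : ℕ → ℝ)
    (hξodd : ∀ n : ℕ, ξ (2 * n + 1) = a n)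
    (hξeven : ∀ n ≥ 1, ξ (2 * n) = c n)
    (hA0 : A 0 = 1) (hA1 : A 1 = 1) (hB0 : B 0 = 0) (hB1 : B 1 = 1)
    (hA : ∀ n : ℕ, A (n + 2) = A (n + 1) - ξ (n + 1) * A n)
    (hB : ∀ n : ℕ, B (n + 2) = B (n + 1) - ξ (n + 1) * B n)
    (hAB : ∀ n ≥ 1, 0 < A (n + 1) ∧ A (n + 1) < B (n + 1))
    (H : ℝ)
    (hH : Filter.Tendsto (fun n : ℕ => A (n + 1) / B (n + 1)) Filter.atTop (nhds H))
    (y0 : ℝ) :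
    (∃ y s : ℕ → ℝ, y 0 = y0 ∧
      (∀ n : ℕ, s (n + 1) * (1 - y n) = a n) ∧
      (∀ n : ℕ, y (n + 1) * (1 - s (n + 1)) = c (n + 1)) ∧
      (0 ≤ y0 ∧ y0 < 1) ∧
      (∀ n ≥ 1, 0 < y n ∧ y n < 1) ∧
      (∀ n ≥ 1, 0 < s n ∧ s n < 1)) ↔
    (0 ≤ y0 ∧ y0 ≤ H) := by
  have hξ : ∀ k, 0 < ξ (k + 1) := by
    intro k
    rcases Nat.even_or_odd' k with ⟨m, rfl | rfl⟩
    · rw [hξodd]; exact (ha m).1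
    · have := hξeven (m + 1) (by omega)
      rw [show 2 * m + 1 + 1 = 2 * (m + 1) by ring, this]
      exact (hc (m + 1) (by omega)).1
  have hBpos : ∀ n, 0 < B (n + 1) := by
    intro n
    rcases Nat.eq_zero_or_pos n with rfl | hn
    · simp [hB1]
    · exact (hAB n hn).1.trans (hAB n hn).2
  have hW : ∀ k, A (k + 1) * B k - A k * B (k + 1) < 0 := by
    intro k
    induction k with
    | zero => simp [hA0, hA1, hB0, hB1]
    | succ k ih =>
      rw [hA, hB]
      nlinarith [mul_neg_of_pos_of_neg (hξ k) ih]
  have hanti : StrictAnti (fun n : ℕ => A (n + 1) / B (n + 1)) := by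
    apply strictAnti_nat_of_succ_lt
    intro n
    rw [div_lt_div_iff₀ (hBpos _) (hBpos _)]
    linarith [hW (n + 1)]
  have hDiff : y0 ≤ H ↔ ∀ k, 0 < A k - y0 * B k := by
    constructor
    · intro h k
      rcases k with _ | k
      · simp [hA0, hB0]
      · have h1 : H ≤ A (k + 1 + 1) / B (k + 1 + 1) := hanti.antitone.le_of_tendsto hH (k + 1)
        have h2 : A (k + 1 + 1) / B (k + 1 + 1) < A (k + 1) / B (k + 1) :=
          hanti (Nat.lt_succ_self k)
        have h3 : y0 < A (k + 1) / B (k + 1) := by linarith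
        rw [lt_div_iff₀ (hBpos k)] at h3
        linarith
    · intro h
      refine ge_of_tendsto' hH fun n => ?_
      rw [le_div_iff₀ (hBpos n)]
      linarith [h (n + 1)]
  have hD : ∀ k, A (k + 2) - y0 * B (k + 2) =
      (A (k + 1) - y0 * B (k + 1)) - ξ (k + 1) * (A k - y0 * B k) := by
    intro k; rw [hA, hB]; ring
  rw [hDiff]
  generalize hDdef : (fun k => A k - y0 * B k) = D
  have hDk : ∀ k, A k - y0 * B k = D k := fun k => congrFun hDdef k
  simp only [hDk] at hD ⊢
  have hD0 : D 0 = 1 := by rw [← hDk]; simp [hA0, hB0]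
  have hD1 : D 1 = 1 - y0 := by rw [← hDk]; simp [hA1, hB1]
  constructor
  · rintro ⟨y, s, hy0, hs, hy, ⟨h0, h1⟩, hyp, hsp⟩
    refine ⟨h0, ?_⟩
    have key : ∀ n, 0 < D (2 * n) ∧ D (2 * n + 1) = (1 - y n) * D (2 * n) := by
      intro n
      induction n with
      | zero => simp [hD0, hD1, hy0]
      | succ n ih =>
        obtain ⟨ih1, ih2⟩ := ih
        have hyn : 0 < 1 - y n := by
          rcases Nat.eq_zero_or_pos n with rfl | hn
          · linarith
          · linarith [(hyp n hn).2]
        have hsn := hsp (n + 1) (by omega)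
        have e1 : D (2 * n + 2) = (1 - s (n + 1)) * D (2 * n + 1) := by
          rw [hD, hξodd, ← hs n, ih2]; ring
        have p1 : 0 < D (2 * n + 1) := by rw [ih2]; exact mul_pos hyn ih1
        have p2 : 0 < D (2 * n + 2) := by
          rw [e1]; exact mul_pos (by linarith) p1
        refine ⟨p2, ?_⟩
        have e2 := hD (2 * n + 1)
        have e3 := hξeven (n + 1) (by omega)
        rw [show 2 * n + 1 + 1 = 2 * (n + 1) by ring, e3, ← hy n] at e2
        rw [show 2 * (n + 1) + 1 = 2 * n + 1 + 2 by ring, e2]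
        rw [show 2 * n + 2 = 2 * (n + 1) by ring] at e1
        rw [e1]; ring
    intro k
    rcases Nat.even_or_odd' k with ⟨m, rfl | rfl⟩
    · exact (key m).1
    · rw [(key m).2]
      refine mul_pos ?_ (key m).1
      rcases Nat.eq_zero_or_pos m with rfl | hm
      · linarith
      · linarith [(hyp m hm).2]
  · rintro ⟨h0, hpos⟩
    have hne : ∀ k, D k ≠ 0 := fun k => (hpos k).ne'
    have hu : ∀ k, 1 - D (k + 2) / D (k + 1) = ξ (k + 1) * D k / D (k + 1) := by
      intro k
      have := hne (k + 1)
      rw [hD]; field_simp; ring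
    have hub : ∀ k, 0 < 1 - D (k + 2) / D (k + 1) ∧ 1 - D (k + 2) / D (k + 1) < 1 := by
      intro k
      refine ⟨?_, ?_⟩
      · rw [hu]; exact div_pos (mul_pos (hξ k) (hpos k)) (hpos _)
      · linarith [div_pos (hpos (k + 2)) (hpos (k + 1))]
    have hrec : ∀ k, (1 - D (k + 2) / D (k + 1)) * (D (k + 1) / D k) = ξ (k + 1) := by
      intro k
      have := hne (k + 1)
      have := hne k
      rw [hu]; field_simp
    refine ⟨fun n => 1 - D (2 * n + 1) / D (2 * n), fun n => 1 - D (2 * n) / D (2 * n - 1),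
      by simp [hD0, hD1], ?_, ?_, ⟨h0, by linarith [hpos 1]⟩, ?_, ?_⟩
    · intro n
      have := hrec (2 * n)
      rw [hξodd] at this
      rw [← this]
      simp only [show 2 * n + 2 - 1 = 2 * n + 1 by omega, show 2 * (n + 1) = 2 * n + 2 by ring]
      ring
    · intro n
      have := hrec (2 * n + 1)
      rw [← hξeven (n + 1) (by omega), show 2 * (n + 1) = 2 * n + 1 + 1 by ring, ← this]
      simp only [show 2 * n + 1 + 1 - 1 = 2 * n + 1 by omega, show 2 * (n + 1) = 2 * n + 1 + 1 by ring]
      ring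
    · intro n hn
      obtain ⟨m, rfl⟩ := Nat.exists_eq_add_of_le' hn
      exact hub (2 * m + 1)
    · intro n hn
      obtain ⟨m, rfl⟩ := Nat.exists_eq_add_of_le' hn
      exact hub (2 * m)
end

section
/- Let (m_n)_{n≥0} be reals with 0 ≤ m_0 < 1 and 0 < m_n < 1 for n ≥ 1, and set ξ_n = (1 - m_{n-1}) m_n for n ≥ 1. Define A_{-1} = 1, A_0 = 1, B_{-1} = 0, B_0 = 1, A_n = A_{n-1} - ξ_n A_{n-2}, B_n = B_{n-1} - ξ_n B_{n-2}. Then for all n ≥ 1: A_n = ∏_{k=1}^n (1-m_k) + m_0 ( Σ_{k=1}^{n-1} m_1⋯m_k (1-m_{k+1})⋯(1-m_n) + ∏_{k=1}^n m_k ) and B_n = ∏_{k=1}^n (1-m_k) + Σ_{k=1}^{n-1} m_1⋯m_k (1-m_{k+1})⋯(1-m_n) + ∏_{k=1}^n m_k; consequently 0 < A_n < B_n for all n ≥ 1. -/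
/-- Remark 2.7: explicit formulas for the numerators `Aₙ` and denominators `Bₙ` of the
convergents of the continued fraction of a chain sequence `ξₙ = (1-mₙ₋₁)mₙ`, and the
resulting inequalities `0 < Aₙ < Bₙ`.  Here `A (n+1)`, `B (n+1)` stand for `Aₙ`, `Bₙ`. -/
theorem chain_sequence_convergents (m ξ A B : ℕ → ℝ)
    (hm0 : 0 ≤ m 0) (hm0' : m 0 < 1)
    (hm : ∀ n ≥ 1, 0 < m n ∧ m n < 1)
    (hξ : ∀ n : ℕ, ξ (n + 1) = (1 - m n) * m (n + 1))
    (hA0 : A 0 = 1) (hA1 : A 1 = 1) (hB0 : B 0 = 0) (hB1 : B 1 = 1)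
    (hA : ∀ n : ℕ, A (n + 2) = A (n + 1) - ξ (n + 1) * A n)
    (hB : ∀ n : ℕ, B (n + 2) = B (n + 1) - ξ (n + 1) * B n) :
    ∀ n ≥ 1,
      A (n + 1) = (∏ k ∈ Finset.Icc 1 n, (1 - m k)) +
        m 0 * ((∑ k ∈ Finset.Icc 1 (n - 1),
          (∏ j ∈ Finset.Icc 1 k, m j) * ∏ j ∈ Finset.Icc (k + 1) n, (1 - m j)) +
          ∏ k ∈ Finset.Icc 1 n, m k) ∧
      B (n + 1) = (∏ k ∈ Finset.Icc 1 n, (1 - m k)) +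
        (∑ k ∈ Finset.Icc 1 (n - 1),
          (∏ j ∈ Finset.Icc 1 k, m j) * ∏ j ∈ Finset.Icc (k + 1) n, (1 - m j)) +
        (∏ k ∈ Finset.Icc 1 n, m k) ∧
      0 < A (n + 1) ∧ A (n + 1) < B (n + 1) := by
  have hP : ∀ n : ℕ, ∏ k ∈ Finset.Icc 1 (n + 1), m k
      = (∏ k ∈ Finset.Icc 1 n, m k) * m (n + 1) := fun n =>
    Finset.prod_Icc_succ_top (by omega) _
  have hQ : ∀ n : ℕ, ∏ k ∈ Finset.Icc 1 (n + 1), (1 - m k)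
      = (∏ k ∈ Finset.Icc 1 n, (1 - m k)) * (1 - m (n + 1)) := fun n =>
    Finset.prod_Icc_succ_top (by omega) _
  have hS : ∀ n : ℕ, (∑ k ∈ Finset.Icc 1 (n + 1),
          (∏ j ∈ Finset.Icc 1 k, m j) * ∏ j ∈ Finset.Icc (k + 1) (n + 2), (1 - m j))
      = (1 - m (n + 2)) * ((∑ k ∈ Finset.Icc 1 n,
          (∏ j ∈ Finset.Icc 1 k, m j) * ∏ j ∈ Finset.Icc (k + 1) (n + 1), (1 - m j))
          + ∏ k ∈ Finset.Icc 1 (n + 1), m k) := by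
    intro n
    rw [Finset.sum_Icc_succ_top (by omega), mul_add, Finset.mul_sum]
    congr 1
    · apply Finset.sum_congr rfl
      intro k hk
      rw [Finset.mem_Icc] at hk
      rw [Finset.prod_Icc_succ_top (by omega : k + 1 ≤ n + 1 + 1)]
      ring
    · rw [show n + 1 + 1 = n + 2 from rfl, Finset.Icc_self, Finset.prod_singleton]
      ring
  have hA' : ∀ n : ℕ, A (n + 2) = (1 - m (n + 1)) * A (n + 1)
      + m 0 * ∏ k ∈ Finset.Icc 1 (n + 1), m k := by
    intro n
    induction n with
    | zero => rw [hA, hξ, hP]; simp [hA0, hA1]; ring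
    | succ n ih => rw [hA, hξ, hP]; linear_combination m (n + 2) * ih
  have hB' : ∀ n : ℕ, B (n + 2) = (1 - m (n + 1)) * B (n + 1)
      + ∏ k ∈ Finset.Icc 1 (n + 1), m k := by
    intro n
    induction n with
    | zero => rw [hB, hξ, hP]; simp [hB0, hB1]
    | succ n ih => rw [hB, hξ, hP]; linear_combination m (n + 2) * ih
  have hPpos : ∀ n : ℕ, 0 < ∏ k ∈ Finset.Icc 1 n, m k := fun n =>
    Finset.prod_pos fun k hk => (hm k (Finset.mem_Icc.1 hk).1).1
  intro n hn
  obtain ⟨n, rfl⟩ : ∃ k, n = k + 1 := ⟨n - 1, by omega⟩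
  clear hn
  rw [Nat.add_sub_cancel]
  induction n with
  | zero =>
    have h1 := hm 1 le_rfl
    have a := hA' 0
    have b := hB' 0
    simp [hA1, hB1] at a b
    refine ⟨by simp [a], by simp [b], ?_, ?_⟩
    · simp only [zero_add, Nat.reduceAdd, a]; nlinarith
    · simp only [zero_add, Nat.reduceAdd, a, b]; nlinarith
  | succ n ih =>
    obtain ⟨i1, i2, i3, i4⟩ := ih
    have h1 := hm (n + 2) (by omega)
    have a := hA' (n + 1)
    have b := hB' (n + 1)
    have p := hPpos (n + 2)
    have h2 : 0 < 1 - m (n + 2) := by linarith [h1.2]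
    refine ⟨?_, ?_, ?_, ?_⟩
    · rw [hS, a, hQ (n + 1)]
      linear_combination (1 - m (n + 2)) * i1
    · rw [hS, b, hQ (n + 1)]
      linear_combination (1 - m (n + 2)) * i2
    · rw [a]
      have := mul_pos h2 i3
      have := mul_nonneg hm0 p.le
      linarith
    · rw [a, b]
      have := mul_lt_mul_of_pos_left i4 h2
      have := mul_lt_mul_of_pos_right hm0' p
      linarith
end

section
/- Let (m_n)_{n≥0} be reals with 0 ≤ m_0 < 1 and 0 < m_n < 1 for n ≥ 1, set ξ_n = (1 - m_{n-1}) m_n for n ≥ 1, and define the convergents A_n/B_n by A_{-1} = 1, A_0 = 1, B_{-1} = 0, B_0 = 1, A_n = A_{n-1} - ξ_n A_{n-2}, B_n = B_{n-1} - ξ_n B_{n-2}. If the series L = Σ_{n=1}^∞ (m_1 m_2 ⋯ m_n)/((1-m_1)(1-m_2)⋯(1-m_n)) converges, then the continued fraction C = 1 - ξ_1/(1 - ξ_2/(1 - ⋯)) converges with lim_{n→∞} A_n/B_n = m_0 + (1-m_0)/(1+L). -/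
/-- Evaluation of the continued fraction of a chain sequence `ξₙ = (1-mₙ₋₁)mₙ`:
if `L = Σₙ (m₁⋯mₙ)/((1-m₁)⋯(1-mₙ))` converges, then the convergents `Aₙ/Bₙ`
(written `A (n+1) / B (n+1)` here) converge to `m₀ + (1-m₀)/(1+L)`. -/
theorem chain_sequence_value (m ξ A B : ℕ → ℝ)
    (hm0 : 0 ≤ m 0) (hm0' : m 0 < 1)
    (hm : ∀ n ≥ 1, 0 < m n ∧ m n < 1)
    (hξ : ∀ n : ℕ, ξ (n + 1) = (1 - m n) * m (n + 1))
    (hA0 : A 0 = 1) (hA1 : A 1 = 1) (hB0 : B 0 = 0) (hB1 : B 1 = 1)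
    (hA : ∀ n : ℕ, A (n + 2) = A (n + 1) - ξ (n + 1) * A n)
    (hB : ∀ n : ℕ, B (n + 2) = B (n + 1) - ξ (n + 1) * B n)
    (L : ℝ)
    (hL : HasSum (fun n : ℕ => ∏ k ∈ Finset.Icc 1 (n + 1), m k / (1 - m k)) L) :
    Filter.Tendsto (fun n : ℕ => A (n + 1) / B (n + 1)) Filter.atTop
      (nhds (m 0 + (1 - m 0) / (1 + L))) := by
  have hlt : ∀ n, 0 < 1 - m n := by
    intro n
    rcases Nat.eq_zero_or_pos n with h | h
    · subst h; linarith
    · linarith [(hm n h).2]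
  -- first order recursions
  have hBrec : ∀ n, B (n + 1) = (1 - m n) * B n + ∏ k ∈ Finset.Icc 1 n, m k := by
    intro n
    induction n with
    | zero => simp [hB0, hB1]
    | succ n ih =>
      rw [Finset.prod_Icc_succ_top (by omega), hB, hξ]
      linear_combination m (n + 1) * ih
  have hArec : ∀ n, A (n + 1) - m 0 * B (n + 1) = (1 - m n) * (A n - m 0 * B n) := by
    intro n
    induction n with
    | zero => simp [hB0, hB1, hA0, hA1]
    | succ n ih =>
      rw [hB, hA, hξ]
      linear_combination m (n + 1) * ih
  have hE : ∀ n, A (n + 1) - m 0 * B (n + 1)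
      = (1 - m 0) * ∏ k ∈ Finset.Icc 1 n, (1 - m k) := by
    intro n
    induction n with
    | zero => simp [hB1, hA1]
    | succ n ih =>
      rw [Finset.prod_Icc_succ_top (by omega), hArec, ih]
      ring
  have hP : ∀ n, 0 < ∏ k ∈ Finset.Icc 1 n, (1 - m k) := fun n =>
    Finset.prod_pos fun k _ => hlt k
  have hBS : ∀ n, B (n + 1) = (∏ k ∈ Finset.Icc 1 n, (1 - m k)) *
      (1 + ∑ i ∈ Finset.range n, ∏ k ∈ Finset.Icc 1 (i + 1), m k / (1 - m k)) := by
    intro n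
    induction n with
    | zero => simp [hB1]
    | succ n ih =>
      have h1 : (∏ k ∈ Finset.Icc 1 (n + 1), (1 - m k)) *
          (∏ k ∈ Finset.Icc 1 (n + 1), m k / (1 - m k)) = ∏ k ∈ Finset.Icc 1 (n + 1), m k := by
        rw [← Finset.prod_mul_distrib]
        exact Finset.prod_congr rfl fun k _ => mul_div_cancel₀ _ (hlt k).ne'
      rw [hBrec, ih, Finset.sum_range_succ, ← h1,
        Finset.prod_Icc_succ_top (f := fun k => 1 - m k) (by omega)]
      ring
  have hpos : ∀ i, 0 ≤ ∏ k ∈ Finset.Icc 1 (i + 1), m k / (1 - m k) := fun i =>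
    Finset.prod_nonneg fun k hk =>
      (div_pos (hm k (Finset.mem_Icc.mp hk).1).1 (hlt k)).le
  have hLpos : 0 ≤ L := hL.nonneg hpos
  have key : ∀ n, A (n + 1) / B (n + 1) = m 0 + (1 - m 0) /
      (1 + ∑ i ∈ Finset.range n, ∏ k ∈ Finset.Icc 1 (i + 1), m k / (1 - m k)) := by
    intro n
    have hS : 0 < 1 + ∑ i ∈ Finset.range n, ∏ k ∈ Finset.Icc 1 (i + 1), m k / (1 - m k) := by
      have := Finset.sum_nonneg fun i (_ : i ∈ Finset.range n) => hpos i
      linarith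
    have h1 := hE n
    have h2 := hBS n
    have h3 := hP n
    generalize 1 + ∑ i ∈ Finset.range n, ∏ k ∈ Finset.Icc 1 (i + 1), m k / (1 - m k) = S at *
    generalize ∏ k ∈ Finset.Icc 1 n, (1 - m k) = P at *
    have h4 : A (n + 1) = m 0 * (P * S) + (1 - m 0) * P := by
      rw [← h2]; linarith
    rw [h4, h2]
    field_simp
  simp only [key]
  exact tendsto_const_nhds.add
    (tendsto_const_nhds.div (tendsto_const_nhds.add hL.tendsto_sum_nat) (by positivity))
end

section
/- Let a and c be reals with 0 < a < 1, 0 < c, and c ≤ (1 - √a)². Define ξ_{2k-1} = c and ξ_{2k} = a for k ≥ 1, and the convergents A_n/B_n by A_{-1} = 1, A_0 = 1, B_{-1} = 0, B_0 = 1, A_n = A_{n-1} - ξ_n A_{n-2}, B_n = B_{n-1} - ξ_n B_{n-2}. Then the continued fraction F = 1 - c/(1 - a/(1 - c/(1 - a/(1 - ⋯)))) converges, with lim_{n→∞} A_n/B_n = (1 + a - c + √((1+a-c)² - 4a))/2. -/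
/-- Proposition 4.1: the 2-periodic continued fraction
`F = 1 - c/(1 - a/(1 - c/(1 - a/(1 - ⋯))))` converges, provided `c ≤ (1-√a)²`, to the
larger root of `F² - (1+a-c)F + a = 0`.  Here `A (n+1)/B (n+1)` are its convergents. -/
theorem periodic_continued_fraction_value (a c : ℝ)
    (ha : 0 < a) (ha1 : a < 1) (hc : 0 < c)
    (hc' : c ≤ (1 - Real.sqrt a) ^ 2)
    (ξ A B : ℕ → ℝ)
    (hξodd : ∀ k ≥ 1, ξ (2 * k - 1) = c)
    (hξeven : ∀ k ≥ 1, ξ (2 * k) = a)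
    (hA0 : A 0 = 1) (hA1 : A 1 = 1) (hB0 : B 0 = 0) (hB1 : B 1 = 1)
    (hA : ∀ n : ℕ, A (n + 2) = A (n + 1) - ξ (n + 1) * A n)
    (hB : ∀ n : ℕ, B (n + 2) = B (n + 1) - ξ (n + 1) * B n) :
    Filter.Tendsto (fun n : ℕ => A (n + 1) / B (n + 1)) Filter.atTop
      (nhds ((1 + a - c + Real.sqrt ((1 + a - c) ^ 2 - 4 * a)) / 2)) := by
  have hs0 : 0 < Real.sqrt a := Real.sqrt_pos.mpr ha
  have hss : Real.sqrt a * Real.sqrt a = a := Real.mul_self_sqrt ha.le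
  have hs1 : Real.sqrt a < 1 := by nlinarith
  have hsum : 2 * Real.sqrt a ≤ 1 + a - c := by nlinarith
  have hdisc : 0 ≤ (1 + a - c) ^ 2 - 4 * a := by nlinarith
  have hr0 := Real.sqrt_nonneg ((1 + a - c) ^ 2 - 4 * a)
  have hrr := Real.mul_self_sqrt hdisc
  have hr1 : Real.sqrt ((1 + a - c) ^ 2 - 4 * a) ≤ 1 - a + c := by
    apply Real.sqrt_le_iff.mpr
    constructor
    · linarith
    · nlinarith
  set r := Real.sqrt ((1 + a - c) ^ 2 - 4 * a) with hr
  obtain ⟨F, hF⟩ : ∃ F, F = (1 + a - c + r) / 2 := ⟨_, rfl⟩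
  rw [← hF]
  have hroot : F ^ 2 - (1 + a - c) * F + a = 0 := by rw [hF]; nlinarith
  have hF1 : F ≤ 1 := by linarith
  have hFs : Real.sqrt a ≤ F := by linarith
  have hFa : a < F := by nlinarith
  have hq0 : 0 ≤ 1 - c - F := by
    by_contra h
    push Not at h
    have h1 : (1 - c - F) * F = a * (1 - F) := by linarith
    have h2 : (1 - c - F) * F < 0 := mul_neg_of_neg_of_pos h (by linarith)
    have h3 : 0 ≤ a * (1 - F) := mul_nonneg ha.le (by linarith)
    linarith
  have hqp : 1 - c - F ≤ F - a := by linarith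
  have hξ1 : ξ 1 = c := hξodd 1 le_rfl
  have hξ2 : ξ 2 = a := hξeven 1 le_rfl
  have hper : ∀ n, ξ (n + 3) = ξ (n + 1) := by
    intro n
    rcases Nat.even_or_odd' n with ⟨k, rfl | rfl⟩
    · have h1 := hξodd (k + 1) (by omega)
      have h2 := hξodd (k + 2) (by omega)
      rw [show 2 * (k + 1) - 1 = 2 * k + 1 by omega] at h1
      rw [show 2 * (k + 2) - 1 = 2 * k + 3 by omega] at h2
      rw [h1, h2]
    · have h1 := hξeven (k + 1) (by omega)
      have h2 := hξeven (k + 2) (by omega)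
      rw [show 2 * k + 1 + 3 = 2 * (k + 2) by omega,
        show 2 * k + 1 + 1 = 2 * (k + 1) by omega, h1, h2]
  have hA2 : A 2 = 1 - c := by rw [hA 0, hA1, hA0, hξ1]; ring
  have hB2 : B 2 = 1 := by rw [hB 0, hB1, hB0, hξ1]; ring
  have hA3 : A 3 = 1 - c - a := by rw [hA 1, hA2, hA1, hξ2]; ring
  have hB3 : B 3 = 1 - a := by rw [hB 1, hB2, hB1, hξ2]; ring
  have hrec : ∀ n, (A (n + 2) = (1 - c) * A n - a * B n ∧ B (n + 2) = A n - a * B n) ∧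
      (A (n + 3) = (1 - c) * A (n + 1) - a * B (n + 1) ∧
        B (n + 3) = A (n + 1) - a * B (n + 1)) := by
    intro n
    induction n with
    | zero => 
      simp only [zero_add, hA0, hA1, hB0, hB1, hA2, hB2, hA3, hB3]
      refine ⟨⟨?_, ?_⟩, ?_, ?_⟩ <;> ring
    | succ n ih =>
      obtain ⟨⟨h1, h2⟩, h3, h4⟩ := ih
      refine ⟨⟨h3, h4⟩, ?_, ?_⟩
      · have e1 := hA (n + 2)
        rw [hper n, h1, h3] at e1
        rw [show n + 1 + 3 = n + 2 + 2 by omega, e1, hA n, hB n]; ring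
      · have e1 := hB (n + 2)
        rw [hper n, h2, h4] at e1
        rw [show n + 1 + 3 = n + 2 + 2 by omega, e1, hA n, hB n]; ring
  have key : ∀ n : ℕ, 0 < B (n + 1) ∧ 0 ≤ A (n + 1) - F * B (n + 1) ∧
      (A (n + 1) - F * B (n + 1)) * n ≤ 2 * (F - a) * B (n + 1) := by
    intro n
    induction n using Nat.twoStepInduction with
    | zero =>
      simp only [zero_add, hA1, hB1]
      refine ⟨by norm_num, by linarith, ?_⟩
      push_cast
      linarith
    | one =>
      simp only [show 1 + 1 = 2 from rfl, hA2, hB2]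
      refine ⟨by norm_num, by linarith, ?_⟩
      push_cast
      linarith
    | more n ih _ =>
      obtain ⟨hb, hd, hn⟩ := ih
      obtain ⟨_, e1, e2⟩ := hrec n
      rw [show n + 2 + 1 = n + 3 by omega]
      have hp : 0 < F - a := by linarith
      have eB : B (n + 3) = (A (n + 1) - F * B (n + 1)) + (F - a) * B (n + 1) := by
        rw [e2]; ring
      have eD : A (n + 3) - F * B (n + 3) = (1 - c - F) * (A (n + 1) - F * B (n + 1)) := by
        rw [e1, e2]; linear_combination (-B (n + 1)) * hroot
      rw [eD, eB]
      generalize A (n + 1) - F * B (n + 1) = D at *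
      generalize B (n + 1) = b at *
      have hpb := mul_pos hp hb
      refine ⟨by linarith, mul_nonneg hq0 hd, ?_⟩
      push_cast
      have hn0 : (0 : ℝ) ≤ n := Nat.cast_nonneg n
      have h1 : (1 - c - F) * (D * (n + 2)) ≤ (F - a) * (D * (n + 2)) :=
        mul_le_mul_of_nonneg_right hqp (by positivity)
      have h2 := mul_le_mul_of_nonneg_left hn hp.le
      linarith
  have hlim : Filter.Tendsto (fun n : ℕ => F + 2 * (F - a) / (n : ℝ)) Filter.atTop (nhds F) := by
    simpa using (tendsto_const_div_atTop_nhds_zero_nat (2 * (F - a))).const_add F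
  refine tendsto_of_tendsto_of_tendsto_of_le_of_le' tendsto_const_nhds hlim ?_ ?_
  · filter_upwards with n
    obtain ⟨hb, hd, _⟩ := key n
    rw [le_div_iff₀ hb]
    linarith
  · filter_upwards [Filter.eventually_gt_atTop 0] with n hn
    obtain ⟨hb, _, hd⟩ := key n
    have hn' : (0 : ℝ) < n := by exact_mod_cast hn
    have h1 : (A (n + 1) - F * B (n + 1)) / B (n + 1) ≤ 2 * (F - a) / n := by
      rw [div_le_div_iff₀ hb hn']
      exact hd
    have h2 : (A (n + 1) - F * B (n + 1)) / B (n + 1) = A (n + 1) / B (n + 1) - F := by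
      field_simp
    linarith
end

section
/- Let a, c, a_0 be reals with 0 < a < 1, 0 < c, c ≤ (1 - √a)², 0 < a_0 < 1, and a_0 ≤ F, where F = (1 + a - c + √((1+a-c)² - 4a))/2. Set a_n = a for n ≥ 1 and c_n = c for n ≥ 1. Fix y_0 ∈ ℝ. Then there exist real sequences (y_n)_{n≥0} and (s_n)_{n≥1} with s_1(1 - y_0) = a_0, s_{n+1}(1 - y_n) = a for n ≥ 1, and y_{n+1}(1 - s_{n+1}) = c for n ≥ 0, satisfying 0 ≤ y_0 < 1, 0 < y_n < 1 for n ≥ 1, and 0 < s_n < 1 for n ≥ 1, if and only if 0 ≤ y_0 ≤ 1 - a_0/F. -/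
/-- The two roots of the fixed point equation. -/
theorem roots_aux (a c : ℝ) (ha : 0 < a) (ha1 : a < 1) (hc : 0 < c)
    (hc' : c ≤ (1 - Real.sqrt a) ^ 2) (F : ℝ)
    (hF : F = (1 + a - c + Real.sqrt ((1 + a - c) ^ 2 - 4 * a)) / 2) :
    ∃ G : ℝ, F + G = 1 + a - c ∧ F * G = a ∧ G ≤ F ∧ 0 < G ∧ F < 1 := by
  have hs := Real.sq_sqrt ha.le
  have hs0 := Real.sqrt_pos.2 ha
  set r := Real.sqrt a with hr
  have h1 : 2 * r ≤ 1 + a - c := by nlinarith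
  have hD : 0 ≤ (1 + a - c) ^ 2 - 4 * a := by nlinarith
  have hd := Real.sq_sqrt hD
  have hd0 := Real.sqrt_nonneg ((1 + a - c) ^ 2 - 4 * a)
  set d := Real.sqrt ((1 + a - c) ^ 2 - 4 * a) with hdd
  have hFpos : 0 < F := by rw [hF]; linarith
  have hprod : F * (1 + a - c - F) = a := by rw [hF]; nlinarith
  have hG : 0 < 1 + a - c - F := by
    by_contra h
    push Not at h
    nlinarith
  refine ⟨1 + a - c - F, by ring, hprod, by linarith, hG, ?_⟩
  by_contra h
  push Not at h
  have : (1 - F) * (1 - (1 + a - c - F)) = c := by linarith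
  have h2 : 0 < 1 - (1 + a - c - F) := by linarith
  nlinarith

/-- Corollary 4.3: for the random walk with constant transition probabilities `a` (up),
`c` (down) away from the origin and boundary entries `1 - a₀, a₀`, a stochastic UL
factorization exists exactly when the free parameter `y₀` lies in `[0, 1 - a₀/F]`,
where `F = (1 + a - c + √((1+a-c)² - 4a))/2`. -/
theorem stochastic_UL_constant_iff (a c a0 : ℝ)
    (ha : 0 < a) (ha1 : a < 1) (hc : 0 < c)
    (hc' : c ≤ (1 - Real.sqrt a) ^ 2)
    (ha0 : 0 < a0) (ha0' : a0 < 1)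
    (ha0F : a0 ≤ (1 + a - c + Real.sqrt ((1 + a - c) ^ 2 - 4 * a)) / 2)
    (y0 : ℝ) :
    (∃ y s : ℕ → ℝ, y 0 = y0 ∧
      s 1 * (1 - y 0) = a0 ∧
      (∀ n ≥ 1, s (n + 1) * (1 - y n) = a) ∧
      (∀ n : ℕ, y (n + 1) * (1 - s (n + 1)) = c) ∧
      (0 ≤ y0 ∧ y0 < 1) ∧
      (∀ n ≥ 1, 0 < y n ∧ y n < 1) ∧
      (∀ n ≥ 1, 0 < s n ∧ s n < 1)) ↔
    (0 ≤ y0 ∧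
      y0 ≤ 1 - a0 / ((1 + a - c + Real.sqrt ((1 + a - c) ^ 2 - 4 * a)) / 2)) := by
  obtain ⟨G, hsum, hprod, hGF, hG, hF1⟩ := roots_aux a c ha ha1 hc hc' _ rfl
  generalize (1 + a - c + Real.sqrt ((1 + a - c) ^ 2 - 4 * a)) / 2 = F at *
  have hF : 0 < F := by linarith
  constructor
  · rintro ⟨y, s, rfl, h1, h2, h3, ⟨hy0, hy1⟩, hy, hs⟩
    refine ⟨hy0, ?_⟩
    by_contra hlt
    push Not at hlt
    have hs1 : F < s 1 := by
      have h4 : (1 - y 0) * F < a0 := by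
        rw [← lt_div_iff₀ hF]; linarith
      have h5 : 0 < 1 - y 0 := by linarith
      by_contra h6
      push Not at h6
      nlinarith
    have key : ∀ n : ℕ, s 1 + n * (s 1 - F) ^ 2 ≤ s (n + 1) := by
      intro n
      induction n with
      | zero => simp
      | succ n ih =>
        have hge : s 1 ≤ s (n + 1) := by
          have : (0 : ℝ) ≤ n * (s 1 - F) ^ 2 := by positivity
          linarith
        obtain ⟨p0, p1⟩ := hy (n + 1) (by omega)
        obtain ⟨q0, q1⟩ := hs (n + 1) (by omega)
        have e1 := h2 (n + 1) (by omega)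
        have e2 := h3 n
        have hstep : (s 1 - F) ^ 2 ≤ s (n + 1 + 1) - s (n + 1) := by
          generalize s (n + 1 + 1) = u at *
          generalize s (n + 1) = t at *
          generalize y (n + 1) = w at *
          have hk : 0 < 1 - t - c := by nlinarith
          have hT : u * (1 - t - c) = a * (1 - t) := by
            have : u * (1 - t - c) = (u * (1 - w)) * (1 - t) := by rw [← e2]; ring
            rw [this, e1]
          have hT2 : (u - t) * (1 - t - c) = (t - F) * (t - G) := by
            have hc2 : c = 1 + a - F - G := by linarith
            have : (u - t) * (1 - t - c) = a * (1 - t) - t * (1 - t - c) := by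
              rw [← hT]; ring
            rw [this, hc2, ← hprod]; ring
          have hA : (s 1 - F) ^ 2 ≤ (t - F) * (t - G) := by
            have : (s 1 - F) * (s 1 - F) ≤ (t - F) * (t - G) :=
              mul_le_mul (by linarith) (by linarith) (by linarith) (by linarith)
            nlinarith
          have hut : 0 ≤ u - t := by
            by_contra h
            push Not at h
            nlinarith [sq_nonneg (s 1 - F)]
          nlinarith
        push_cast
        linarith
    have hpos : 0 < (s 1 - F) ^ 2 := by
      have : 0 < s 1 - F := by linarith
      positivity
    obtain ⟨n, hn⟩ := exists_nat_gt (1 / (s 1 - F) ^ 2)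
    rw [div_lt_iff₀ hpos] at hn
    have := key n
    have := (hs (n + 1) (by omega)).2
    linarith
  · rintro ⟨hy0, hy1⟩
    have hq : 0 < a0 / F := by positivity
    have hy : y0 < 1 := by linarith
    have hs1 : a0 / (1 - y0) ≤ F := by
      rw [div_le_iff₀ (by linarith)]
      have : a0 / F ≤ 1 - y0 := by linarith
      rw [div_le_iff₀ hF] at this
      linarith
    let S : ℕ → ℝ := fun n => Nat.rec (a0 / (1 - y0)) (fun _ t => a * (1 - t) / (1 - t - c)) n
    have S0 : S 0 = a0 / (1 - y0) := rfl
    have SS : ∀ n, S (n + 1) = a * (1 - S n) / (1 - S n - c) := fun n => rfl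
    have hFc : c < 1 - F := by nlinarith
    have hS : ∀ n, 0 < S n ∧ S n ≤ F := by
      intro n
      induction n with
      | zero => rw [S0]; exact ⟨div_pos ha0 (by linarith), hs1⟩
      | succ n ih =>
        obtain ⟨i0, i1⟩ := ih
        rw [SS]
        have hk : 0 < 1 - S n - c := by linarith
        refine ⟨div_pos (mul_pos ha (by linarith)) hk, ?_⟩
        rw [div_le_iff₀ hk]
        have hc2 : c = 1 + a - F - G := by linarith
        have e : F * (1 - S n - c) - a * (1 - S n) = F * (1 - G) * (F - S n) := by
          rw [hc2, ← hprod]; ring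
        have : 0 ≤ F * (1 - G) * (F - S n) :=
          mul_nonneg (mul_nonneg hF.le (by linarith)) (by linarith)
        linarith
    refine ⟨fun n => Nat.casesOn n y0 (fun m => c / (1 - S m)), fun n => S (n - 1),
      rfl, ?_, ?_, ?_, ⟨hy0, hy⟩, ?_, ?_⟩
    · change S 0 * (1 - y0) = a0
      rw [S0]
      exact div_mul_cancel₀ _ (ne_of_gt (by linarith))
    · intro n hn
      obtain ⟨m, rfl⟩ : ∃ m, n = m + 1 := ⟨n - 1, by omega⟩
      change S (m + 1) * (1 - c / (1 - S m)) = a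
      have := hS m
      have k1 : 1 - S m ≠ 0 := ne_of_gt (by linarith)
      have k2 : 1 - S m - c ≠ 0 := ne_of_gt (by linarith)
      rw [SS]
      field_simp
    · intro n
      change c / (1 - S n) * (1 - S n) = c
      have := hS n
      exact div_mul_cancel₀ _ (ne_of_gt (by linarith))
    · intro n hn
      obtain ⟨m, rfl⟩ : ∃ m, n = m + 1 := ⟨n - 1, by omega⟩
      change 0 < c / (1 - S m) ∧ c / (1 - S m) < 1
      have := hS m
      refine ⟨div_pos hc (by linarith), ?_⟩
      rw [div_lt_one (by linarith)]
      linarith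
    · intro n hn
      have := hS (n - 1)
      exact ⟨this.1, by linarith⟩
end

section
/- Let 0 < a_0 ≤ 1/2 and 0 ≤ y_0 ≤ 1 - 2a_0, and set D = 1 - y_0 - 2a_0 ≥ 0. Define y_n = (2a_0 + (2n-1)D)/(4a_0 + 4nD) and s_n = (a_0 + (n-1)D)/(2a_0 + (2n-1)D) for n ≥ 1. Then s_1(1 - y_0) = a_0, and for all n ≥ 1: s_{n+1}(1 - y_n) = 1/4 and y_n(1 - s_n) = 1/4; moreover 0 < y_n < 1 and 0 < s_n < 1 for all n ≥ 1. -/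
/-- Explicit coefficients of the stochastic UL factorization for the random walk with
constant transition probabilities `a = c = 1/4`, `b = 1/2` and boundary entries
`1 - a₀, a₀`, with free parameter `y₀ ∈ [0, 1 - 2a₀]`. -/
theorem UL_coefficients_constant_quarter (a0 y0 : ℝ)
    (ha0 : 0 < a0) (ha0' : a0 ≤ 1 / 2)
    (hy0 : 0 ≤ y0) (hy0' : y0 ≤ 1 - 2 * a0) :
    let D : ℝ := 1 - y0 - 2 * a0
    let y : ℕ → ℝ := fun n => (2 * a0 + (2 * (n : ℝ) - 1) * D) / (4 * a0 + 4 * (n : ℝ) * D)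
    let s : ℕ → ℝ := fun n => (a0 + ((n : ℝ) - 1) * D) / (2 * a0 + (2 * (n : ℝ) - 1) * D)
    0 ≤ D ∧
    s 1 * (1 - y0) = a0 ∧
    (∀ n ≥ 1, s (n + 1) * (1 - y n) = 1 / 4) ∧
    (∀ n ≥ 1, y n * (1 - s n) = 1 / 4) ∧
    (∀ n ≥ 1, 0 < y n ∧ y n < 1) ∧
    (∀ n ≥ 1, 0 < s n ∧ s n < 1) := by
  intro D y s
  have hD : 0 ≤ D := by simp only [D]; linarith
  have hDy : 1 - y0 = 2 * a0 + D := by simp only [D]; ring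
  clear_value D
  -- positivity of the quantities `a₀ + (n-1) D` and `a₀ + n D`
  have hp : ∀ n : ℕ, n ≥ 1 → 0 < a0 + ((n : ℝ) - 1) * D ∧ 0 < a0 + (n : ℝ) * D := by
    intro n hn
    have h1 : (1 : ℝ) ≤ n := by exact_mod_cast hn
    have h2 : 0 ≤ ((n : ℝ) - 1) * D := mul_nonneg (by linarith) hD
    constructor <;> linarith
  refine ⟨hD, ?_, ?_, ?_, ?_, ?_⟩
  · have h : 2 * a0 + D ≠ 0 := by positivity
    have e : s 1 = a0 / (2 * a0 + D) := by
      simp only [s]; norm_num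
    rw [e, hDy]
    field_simp
  · intro n hn
    obtain ⟨_, h2⟩ := hp n hn
    have hA : 4 * a0 + 4 * (n : ℝ) * D ≠ 0 := ne_of_gt (by linarith)
    have hB : 2 * a0 + (2 * (n : ℝ) + 1) * D ≠ 0 := ne_of_gt (by linarith)
    have e1 : s (n + 1) = (a0 + n * D) / (2 * a0 + (2 * (n : ℝ) + 1) * D) := by
      simp only [s]; push_cast; congr 1 <;> ring
    have e2 : 1 - y n = (2 * a0 + (2 * (n : ℝ) + 1) * D) / (4 * a0 + 4 * (n : ℝ) * D) := by
      simp only [y]; rw [eq_div_iff hA, sub_mul, div_mul_cancel₀ _ hA]; ring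
    rw [e1, e2, div_mul_div_comm, div_eq_div_iff (mul_ne_zero hB hA) (by norm_num)]
    ring
  · intro n hn
    obtain ⟨h1, h2⟩ := hp n hn
    have hA : 4 * a0 + 4 * (n : ℝ) * D ≠ 0 := ne_of_gt (by linarith)
    have hB : 2 * a0 + (2 * (n : ℝ) - 1) * D ≠ 0 := ne_of_gt (by linarith)
    have e2 : 1 - s n = (a0 + n * D) / (2 * a0 + (2 * (n : ℝ) - 1) * D) := by
      simp only [s]; rw [eq_div_iff hB, sub_mul, div_mul_cancel₀ _ hB]; ring
    rw [e2]
    simp only [y]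
    rw [div_mul_div_comm, div_eq_div_iff (mul_ne_zero hA hB) (by norm_num)]
    ring
  · intro n hn
    obtain ⟨h1, h2⟩ := hp n hn
    have hA : 0 < 4 * a0 + 4 * (n : ℝ) * D := by linarith
    have hB : 0 < 2 * a0 + (2 * (n : ℝ) - 1) * D := by linarith
    refine ⟨div_pos hB hA, ?_⟩
    simp only [y]
    rw [div_lt_one hA]
    linarith
  · intro n hn
    obtain ⟨h1, h2⟩ := hp n hn
    have hB : 0 < 2 * a0 + (2 * (n : ℝ) - 1) * D := by linarith
    refine ⟨div_pos h1 hB, ?_⟩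
    simp only [s]
    rw [div_lt_one hB]
    linarith
end

section
/- Let 0 < a_0 < 1/2. Define sequences (x̃_n)_{n≥0} and (r̃_n)_{n≥1} by x̃_0 = a_0, r̃_{n+1} = (1/4)/(1 - x̃_n) for n ≥ 0, and x̃_{n+1} = (1/4)/(1 - r̃_{n+1}) for n ≥ 0. Then these sequences are well defined (all denominators are nonzero) and for every n ≥ 1, r̃_n = (2a_0 + (2n-1)(1-2a_0))/(4a_0 + 4n(1-2a_0)); in particular 0 < r̃_n < 1 for all n ≥ 1. -/
/-- Explicit coefficients of the (unique) stochastic LU factorization of the random walk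
with constant transition probabilities `a = c = 1/4`, `b = 1/2` and boundary entries
`1 - a₀, a₀`: the recursions (recr)-(recx) are well defined and give the closed formula
for `r̃ₙ`. -/
theorem LU_coefficients_constant_quarter (a0 : ℝ)
    (ha0 : 0 < a0) (ha0' : a0 < 1 / 2)
    (xt rt : ℕ → ℝ)
    (hx0 : xt 0 = a0)
    (hr : ∀ n : ℕ, rt (n + 1) = (1 / 4) / (1 - xt n))
    (hx : ∀ n : ℕ, xt (n + 1) = (1 / 4) / (1 - rt (n + 1))) :
    (∀ n : ℕ, 1 - xt n ≠ 0) ∧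
    (∀ n : ℕ, 1 - rt (n + 1) ≠ 0) ∧
    (∀ n ≥ 1, rt n =
      (2 * a0 + (2 * (n : ℝ) - 1) * (1 - 2 * a0)) / (4 * a0 + 4 * (n : ℝ) * (1 - 2 * a0))) ∧
    (∀ n ≥ 1, 0 < rt n ∧ rt n < 1) := by
  obtain ⟨d, hd⟩ : ∃ d, d = 1 - 2 * a0 := ⟨_, rfl⟩
  have hdpos : 0 < d := by linarith
  rw [← hd]
  have hA : ∀ n : ℕ, 0 < a0 + (n : ℝ) * d := fun n => by positivity
  have hB : ∀ n : ℕ, 0 < 2 * a0 + (2 * (n : ℝ) + 1) * d := fun n => by positivity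
  have hA' : ∀ n : ℕ, 0 < a0 + ((n : ℝ) + 1) * d := fun n => by positivity
  have step1 : ∀ n : ℕ, xt n = (a0 + n * d) / (2 * a0 + (2 * (n : ℝ) + 1) * d) →
      1 - xt n = (a0 + ((n : ℝ) + 1) * d) / (2 * a0 + (2 * (n : ℝ) + 1) * d) := by
    intro n h
    have := (hB n).ne'
    rw [h, eq_div_iff this, sub_mul, div_mul_cancel₀ _ this]
    ring
  have step2 : ∀ n : ℕ, xt n = (a0 + n * d) / (2 * a0 + (2 * (n : ℝ) + 1) * d) →
      rt (n + 1) = (2 * a0 + (2 * (n : ℝ) + 1) * d) / (4 * (a0 + ((n : ℝ) + 1) * d)) := by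
    intro n h
    rw [hr, step1 n h, div_div_eq_mul_div, div_mul_eq_mul_div, div_div, one_mul]
  have step3 : ∀ n : ℕ, xt n = (a0 + n * d) / (2 * a0 + (2 * (n : ℝ) + 1) * d) →
      1 - rt (n + 1) = (2 * a0 + (2 * (n : ℝ) + 3) * d) / (4 * (a0 + ((n : ℝ) + 1) * d)) := by
    intro n h
    have : 4 * (a0 + ((n : ℝ) + 1) * d) ≠ 0 := by have := hA' n; positivity
    rw [step2 n h, eq_div_iff this, sub_mul, div_mul_cancel₀ _ this]
    ring
  have key : ∀ n : ℕ, xt n = (a0 + n * d) / (2 * a0 + (2 * (n : ℝ) + 1) * d) := by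
    intro n
    induction n with
    | zero =>
      rw [hx0, eq_div_iff (hB 0).ne', hd]
      push_cast
      ring
    | succ k ih =>
      have h3 : 0 < 2 * a0 + (2 * (k : ℝ) + 3) * d := by positivity
      have h4 := hB (k + 1)
      rw [hx, step3 k ih, div_div_eq_mul_div, div_eq_div_iff h3.ne' h4.ne']
      push_cast
      ring
  have hC : ∀ n : ℕ, 0 < 1 - rt (n + 1) := fun n => by
    rw [step3 n (key n)]
    positivity
  refine ⟨fun n => ?_, fun n => (hC n).ne', ?_, ?_⟩
  · rw [step1 n (key n)]
    exact (div_pos (hA' n) (hB n)).ne'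
  · intro n hn
    obtain ⟨k, rfl⟩ := Nat.exists_eq_add_of_le' hn
    rw [step2 k (key k)]
    push_cast
    congr 1 <;> ring
  · intro n hn
    obtain ⟨k, rfl⟩ := Nat.exists_eq_add_of_le' hn
    refine ⟨?_, by linarith [hC k]⟩
    rw [step2 k (key k)]
    positivity
end

section
/- Let 0 < a_0 < 1/2. Then ∫_0^1 (2a_0/(π((4a_0-1)x + (1-2a_0)²))) √(x/(1-x)) · (1/x) dx = 1/(1-2a_0); in particular the linear factor (4a_0-1)x + (1-2a_0)² is strictly positive on [0,1], so the integrand is well defined. -/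
/-- The moment `μ₋₁ = ∫₀¹ ω(x)/x dx = 1/(1-2a₀)` of the spectral measure
`ω(x) = (2a₀/(π((4a₀-1)x + (1-2a₀)²)))√(x/(1-x))` of the random walk with constant
transition probabilities `a = c = 1/4`, `b = 1/2` and boundary entries `1-a₀, a₀`. -/
theorem moment_minus_one_constant_quarter (a0 : ℝ)
    (ha0 : 0 < a0) (ha0' : a0 < 1 / 2) :
    (∀ x ∈ Set.Icc (0 : ℝ) 1, 0 < (4 * a0 - 1) * x + (1 - 2 * a0) ^ 2) ∧
    ∫ x in (0 : ℝ)..1,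
        (2 * a0 / (Real.pi * ((4 * a0 - 1) * x + (1 - 2 * a0) ^ 2))) *
          Real.sqrt (x / (1 - x)) * (1 / x) = 1 / (1 - 2 * a0) := by
  have hQ : ∀ x ∈ Set.Icc (0 : ℝ) 1, 0 < (4 * a0 - 1) * x + (1 - 2 * a0) ^ 2 := by
    rintro x ⟨hx0, hx1⟩
    have e : (4 * a0 - 1) * x + (1 - 2 * a0) ^ 2
        = (2 * a0) ^ 2 * x + (1 - 2 * a0) ^ 2 * (1 - x) := by ring
    rw [e]
    have h1 : 0 < (2 * a0) ^ 2 := by positivity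
    have h2 : 0 < (1 - 2 * a0) ^ 2 := by
      have : 0 < 1 - 2 * a0 := by linarith
      positivity
    rcases hx0.eq_or_lt with h | h
    · subst h; simpa using h2
    · have := mul_pos h1 h
      have := mul_nonneg h2.le (sub_nonneg.2 hx1)
      linarith
  refine ⟨hQ, ?_⟩
  have hd : 0 < 1 - 2 * a0 := by linarith
  have hpi := Real.pi_pos
  set G : ℝ → ℝ := fun x => 1 / (Real.pi * (1 - 2 * a0)) *
    Real.arccos (1 - 2 * (2 * a0) ^ 2 * x / ((4 * a0 - 1) * x + (1 - 2 * a0) ^ 2)) with hG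
  have hcont : ContinuousOn G (Set.Icc 0 1) := by
    refine continuousOn_const.mul (Real.continuous_arccos.comp_continuousOn ?_)
    refine continuousOn_const.sub (ContinuousOn.div (by fun_prop) (by fun_prop) ?_)
    intro x hx
    exact (hQ x hx).ne'
  have hder : ∀ x ∈ Set.Ioo (0 : ℝ) 1, HasDerivAt G
      ((2 * a0 / (Real.pi * ((4 * a0 - 1) * x + (1 - 2 * a0) ^ 2))) *
          Real.sqrt (x / (1 - x)) * (1 / x)) x := by
    intro x hx
    have hq := hQ x ⟨hx.1.le, hx.2.le⟩
    have hx0 := hx.1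
    have hx1 : 0 < 1 - x := sub_pos.2 hx.2
    have hw : HasDerivAt
        (fun x : ℝ => 1 - 2 * (2 * a0) ^ 2 * x / ((4 * a0 - 1) * x + (1 - 2 * a0) ^ 2))
        (-(2 * (2 * a0) ^ 2 * (1 - 2 * a0) ^ 2 /
          ((4 * a0 - 1) * x + (1 - 2 * a0) ^ 2) ^ 2)) x := by
      have h1 : HasDerivAt (fun x : ℝ => 2 * (2 * a0) ^ 2 * x) (2 * (2 * a0) ^ 2) x := by
        simpa using (hasDerivAt_id x).const_mul (2 * (2 * a0) ^ 2)
      have h2 : HasDerivAt (fun x : ℝ => (4 * a0 - 1) * x + (1 - 2 * a0) ^ 2)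
          (4 * a0 - 1) x := by
        simpa using ((hasDerivAt_id x).const_mul (4 * a0 - 1)).add_const ((1 - 2 * a0) ^ 2)
      refine ((h1.div h2 hq.ne').const_sub 1).congr_deriv ?_
      rw [neg_inj]
      congr 1
      ring
    set Q := (4 * a0 - 1) * x + (1 - 2 * a0) ^ 2 with hQd
    have hs : 0 < Real.sqrt (x * (1 - x)) := Real.sqrt_pos.2 (mul_pos hx0 hx1)
    have hsq : 1 - (1 - 2 * (2 * a0) ^ 2 * x / Q) ^ 2
        = (2 * (2 * a0) * (1 - 2 * a0) / Q) ^ 2 * (x * (1 - x)) := by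
      field_simp
      rw [hQd]
      ring
    have hk : 0 < 2 * (2 * a0) * (1 - 2 * a0) / Q := by positivity
    have hpos : 0 < 1 - (1 - 2 * (2 * a0) ^ 2 * x / Q) ^ 2 := by
      rw [hsq]; positivity
    have hn1 : 1 - 2 * (2 * a0) ^ 2 * x / Q ≠ -1 := by
      intro h; rw [h] at hpos; norm_num at hpos
    have hn2 : 1 - 2 * (2 * a0) ^ 2 * x / Q ≠ 1 := by
      intro h; rw [h] at hpos; norm_num at hpos
    have hcomp := ((Real.hasDerivAt_arccos hn1 hn2).comp x hw).const_mul
      (1 / (Real.pi * (1 - 2 * a0)))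
    have hr : Real.sqrt (x / (1 - x)) = x / Real.sqrt (x * (1 - x)) := by
      rw [Real.sqrt_eq_iff_mul_self_eq (by positivity) (by positivity),
        div_mul_div_comm, Real.mul_self_sqrt (by positivity)]
      field_simp
    refine hcomp.congr_deriv ?_
    rw [hsq, Real.sqrt_mul (sq_nonneg _), Real.sqrt_sq hk.le, hr]
    field_simp
  have hint : IntervalIntegrable (fun x : ℝ =>
      (2 * a0 / (Real.pi * ((4 * a0 - 1) * x + (1 - 2 * a0) ^ 2))) *
          Real.sqrt (x / (1 - x)) * (1 / x)) MeasureTheory.volume 0 1 := by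
    refine intervalIntegral.intervalIntegrable_deriv_of_nonneg (g := G) ?_ ?_ ?_
    · rwa [Set.uIcc_of_le zero_le_one]
    · simpa using hder
    · intro x hx
      simp only [zero_le_one, min_eq_left, max_eq_right] at hx
      have hq := hQ x ⟨hx.1.le, hx.2.le⟩
      have hx0 := hx.1
      positivity
  rw [intervalIntegral.integral_eq_sub_of_hasDerivAt_of_le zero_le_one hcont hder hint]
  have e1 : (1 : ℝ) - 2 * (2 * a0) ^ 2 * 1 / ((4 * a0 - 1) * 1 + (1 - 2 * a0) ^ 2) = -1 := by
    have : (4 * a0 - 1) * 1 + (1 - 2 * a0) ^ 2 = (2 * a0) ^ 2 := by ring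
    rw [this]
    rw [mul_one, mul_div_assoc, div_self (by positivity)]
    norm_num
  simp only [hG]
  rw [e1]
  simp
end

section
/- Let α > 0 and β > -1 be reals, and define m_{2n} = n/(2n+α+β+1) and m_{2n+1} = (n+β+1)/(2n+α+β+2) for n ≥ 0. Then the series L = Σ_{n=1}^∞ (m_1 m_2 ⋯ m_n)/((1-m_1)(1-m_2)⋯(1-m_n)) converges and L = (β+1)/α. -/
/-- Telescoping with vanishing remainder. -/
lemma hasSum_of_remainder (t R : ℕ → ℝ) (a C : ℝ) (ha : 0 < a) (hC : 0 < C)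
    (ht : ∀ k, 0 ≤ t k) (hR : ∀ k, 0 ≤ R k) (hd : ∀ k, R k - R (k + 1) = t k)
    (hb : ∀ k : ℕ, a * R k ≤ t k * ((k : ℝ) + C)) : HasSum t (R 0) := by
  have hs : ∀ n, ∑ k ∈ Finset.range n, t k = R 0 - R n := by
    intro n
    induction n with
    | zero => simp
    | succ n ih => rw [Finset.sum_range_succ, ih, ← hd n]; ring
  have hsum : Summable t := summable_of_sum_range_le (c := R 0) ht (fun n => by
    rw [hs]; linarith [hR n])
  have hlim : Filter.Tendsto R Filter.atTop (nhds (R 0 - ∑' k, t k)) := by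
    have h := (hsum.hasSum.tendsto_sum_nat).const_sub (R 0)
    refine h.congr (fun n => ?_)
    rw [hs]; ring
  have hanti : Antitone R := antitone_nat_of_succ_le (fun n => by linarith [hd n, ht n])
  set u := R 0 - ∑' k, t k with hu
  have hu0 : 0 ≤ u := ge_of_tendsto' hlim hR
  have hle : ∀ k, u ≤ R k := fun k => hanti.le_of_tendsto hlim k
  have huz : u = 0 := by
    by_contra hne
    have hup : 0 < u := lt_of_le_of_ne hu0 (Ne.symm hne)
    obtain ⟨N, hN⟩ := exists_nat_ge C
    have h1 : Summable (fun k : ℕ => 1 / (((k + N : ℕ) : ℝ))) := by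
      refine Summable.of_nonneg_of_le (fun k => by positivity) (fun k => ?_)
        (hsum.mul_left (1 / (a * u)))
      have hk : 0 < (k : ℝ) + C := by positivity
      have hkN : (k : ℝ) + C ≤ ((k + N : ℕ) : ℝ) := by push_cast; linarith
      have h2 : a * u ≤ t k * ((k + N : ℕ) : ℝ) := by
        calc a * u ≤ a * R k := by gcongr; exact hle k
          _ ≤ _ := hb k
          _ ≤ _ := mul_le_mul_of_nonneg_left hkN (ht k)
      rw [one_div_mul_eq_div, div_le_div_iff₀ (by linarith) (by positivity)]
      linarith
    have h3 := (summable_nat_add_iff (f := fun k : ℕ => 1 / (k : ℝ)) N).1 h1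
    exact Real.not_summable_one_div_natCast h3
  have : R 0 = ∑' k, t k := by linarith
  rw [this]
  exact hsum.hasSum

/-- The series `L = Σₙ (m₁⋯mₙ)/((1-m₁)⋯(1-mₙ))` for the chain-sequence parameters of the
Jacobi random walk converges to `(β+1)/α`. -/
theorem jacobi_chain_sequence_sum (α β : ℝ) (hα : 0 < α) (hβ : -1 < β)
    (m : ℕ → ℝ)
    (hme : ∀ n : ℕ, m (2 * n) = (n : ℝ) / (2 * (n : ℝ) + α + β + 1))
    (hmo : ∀ n : ℕ, m (2 * n + 1) = ((n : ℝ) + β + 1) / (2 * (n : ℝ) + α + β + 2)) :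
    HasSum (fun n : ℕ => ∏ k ∈ Finset.Icc 1 (n + 1), m k / (1 - m k)) ((β + 1) / α) := by
  obtain ⟨b, rfl⟩ : ∃ b, β = b - 1 := ⟨β + 1, by ring⟩
  have hb : 0 < b := by linarith
  have he : ∀ n : ℕ, m (2 * n) / (1 - m (2 * n)) = (n : ℝ) / (n + α + b) := by
    intro n
    have h1 : (0 : ℝ) < 2 * n + α + b := by positivity
    have h2 : (0 : ℝ) < n + α + b := by positivity
    have e1 : 1 - m (2 * n) = (n + α + b) / (2 * n + α + b) := by
      rw [hme, show 2 * (n : ℝ) + α + (b - 1) + 1 = 2 * n + α + b by ring]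
      field_simp; ring
    rw [e1, hme, show 2 * (n : ℝ) + α + (b - 1) + 1 = 2 * n + α + b by ring]
    field_simp
  have ho : ∀ n : ℕ, m (2 * n + 1) / (1 - m (2 * n + 1)) = ((n : ℝ) + b) / (n + α + 1) := by
    intro n
    have h1 : (0 : ℝ) < 2 * n + α + b + 1 := by positivity
    have h2 : (0 : ℝ) < n + α + 1 := by positivity
    have e0 : m (2 * n + 1) = (n + b) / (2 * n + α + b + 1) := by
      rw [hmo]; congr 1 <;> ring
    have e1 : 1 - m (2 * n + 1) = (n + α + 1) / (2 * n + α + b + 1) := by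
      rw [e0]; field_simp; ring
    rw [e1, e0]
    field_simp
  set t : ℕ → ℝ := fun n => ∏ k ∈ Finset.Icc 1 n, m k / (1 - m k) with htdef
  have ht0 : t 0 = 1 := by simp [htdef]
  have hts : ∀ n, t (n + 1) = t n * (m (n + 1) / (1 - m (n + 1))) := fun n =>
    Finset.prod_Icc_succ_top (by omega) _
  have htn : ∀ n, 0 ≤ t n := by
    intro n
    refine Finset.prod_nonneg (fun k _ => ?_)
    obtain ⟨j, rfl | rfl⟩ := Nat.even_or_odd' k
    · rw [he]; positivity
    · rw [ho]; positivity
  set d : ℕ → ℝ := fun k => if k % 2 = 0 then ((k : ℝ) / 2 + α + b) / α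
    else (((k : ℝ) + 1) / 2 + α) / α with hddef
  have hde : ∀ n : ℕ, d (2 * n) = (n + α + b) / α := by
    intro n; simp [hddef]
  have hdo : ∀ n : ℕ, d (2 * n + 1) = (n + α + 1) / α := by
    intro n
    have : (2 * n + 1) % 2 ≠ 0 := by omega
    simp only [hddef, if_neg this]; push_cast; ring
  have hmain : HasSum t (t 0 * d 0) := by
    refine hasSum_of_remainder t (fun k => t k * d k) α (1 + α + b) hα (by positivity) htn ?_ ?_ ?_
    · intro k
      refine mul_nonneg (htn k) ?_
      obtain ⟨j, rfl | rfl⟩ := Nat.even_or_odd' k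
      · rw [hde]; positivity
      · rw [hdo]; positivity
    · intro k
      obtain ⟨j, rfl | rfl⟩ := Nat.even_or_odd' k
      · have h2 : (0 : ℝ) < j + α + 1 := by positivity
        simp only [hts, ho, hde, hdo]
        field_simp; ring
      · have h2 : (0 : ℝ) < j + 1 + α + b := by positivity
        have e2 : 2 * j + 1 + 1 = 2 * (j + 1) := by ring
        have e3 : t (2 * (j + 1)) = t (2 * j + 1) * ((j + 1) / (j + 1 + α + b)) := by
          rw [← e2, hts, e2, he]; push_cast; rfl
        simp only [e2, e3, hde, hdo]
        push_cast
        field_simp; ring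
    · intro k
      have : α * d k ≤ (k : ℝ) + (1 + α + b) := by
        obtain ⟨j, rfl | rfl⟩ := Nat.even_or_odd' k
        · have hj : (0 : ℝ) ≤ j := by positivity
          rw [hde, mul_div_cancel₀ _ hα.ne']; push_cast; linarith
        · have hj : (0 : ℝ) ≤ j := by positivity
          rw [hdo, mul_div_cancel₀ _ hα.ne']; push_cast; linarith
      calc α * (t k * d k) = t k * (α * d k) := by ring
        _ ≤ _ := mul_le_mul_of_nonneg_left this (htn k)
  have hfin : HasSum (fun n => t (n + 1)) ((b - 1 + 1) / α) := by
    rw [hasSum_nat_add_iff (f := t) 1]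
    have h0 := hde 0
    simp only [Nat.mul_zero, Nat.cast_zero] at h0
    have key : (b - 1 + 1) / α + ∑ i ∈ Finset.range 1, t i = t 0 * d 0 := by
      rw [h0, Finset.sum_range_one, ht0]
      field_simp; ring
    rw [key]
    exact hmain
  exact hfin
end

section
/- Let α > 0 and β > -1 be reals. Define a_n = ((n+β+1)(n+1+α+β))/((2n+α+β+1)(2n+2+α+β)) for n ≥ 0, c_n = (n(n+α))/((2n+α+β+1)(2n+α+β)) for n ≥ 1, and m̃_{2n} = (n+β+1)/(2n+α+β+2), m̃_{2n+1} = (n+1)/(2n+α+β+3) for n ≥ 0. Then: (i) c_{n+1} = (1 - m̃_{2n}) m̃_{2n+1} and a_{n+1} = (1 - m̃_{2n+1}) m̃_{2n+2} for all n ≥ 0; (ii) the series L̃ = Σ_{n=1}^∞ (m̃_1 ⋯ m̃_n)/((1-m̃_1)⋯(1-m̃_n)) converges with L̃ = 1/α; and (iii) consequently H̃ := m̃_0 + (1-m̃_0)/(1+L̃) = (α+β+1)/(α+β+2), which satisfies a_0 = (β+1)/(α+β+2) ≤ H̃. -/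
/-- The sequence `c₁, a₁, c₂, a₂, …` of the Jacobi random walk is a chain sequence with
parameters `m̃₂ₙ = (n+β+1)/(2n+α+β+2)`, `m̃₂ₙ₊₁ = (n+1)/(2n+α+β+3)`; the associated series
converges to `L̃ = 1/α`, so the continued fraction `H̃ = m̃₀ + (1-m̃₀)/(1+L̃)` equals
`(α+β+1)/(α+β+2)`, and `a₀ = (β+1)/(α+β+2) ≤ H̃`. -/
theorem jacobi_LU_chain_sequence (α β : ℝ) (hα : 0 < α) (hβ : -1 < β)
    (mt : ℕ → ℝ)
    (hmte : ∀ n : ℕ, mt (2 * n) = ((n : ℝ) + β + 1) / (2 * (n : ℝ) + α + β + 2))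
    (hmto : ∀ n : ℕ, mt (2 * n + 1) = ((n : ℝ) + 1) / (2 * (n : ℝ) + α + β + 3)) :
    let a : ℕ → ℝ := fun n =>
      (((n : ℝ) + β + 1) * ((n : ℝ) + 1 + α + β)) /
        ((2 * (n : ℝ) + α + β + 1) * (2 * (n : ℝ) + 2 + α + β))
    let c : ℕ → ℝ := fun n =>
      ((n : ℝ) * ((n : ℝ) + α)) / ((2 * (n : ℝ) + α + β + 1) * (2 * (n : ℝ) + α + β))
    (∀ n : ℕ, c (n + 1) = (1 - mt (2 * n)) * mt (2 * n + 1)) ∧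
    (∀ n : ℕ, a (n + 1) = (1 - mt (2 * n + 1)) * mt (2 * n + 2)) ∧
    HasSum (fun n : ℕ => ∏ k ∈ Finset.Icc 1 (n + 1), mt k / (1 - mt k)) (1 / α) ∧
    mt 0 + (1 - mt 0) / (1 + 1 / α) = (α + β + 1) / (α + β + 2) ∧
    a 0 = (β + 1) / (α + β + 2) ∧
    a 0 ≤ (α + β + 1) / (α + β + 2) := by
  intro a c
  have hn : ∀ n : ℕ, (0:ℝ) ≤ n := fun n => Nat.cast_nonneg n
  have hre : ∀ n : ℕ, mt (2 * n) / (1 - mt (2 * n)) = ((n:ℝ) + β + 1) / (n + α + 1) := by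
    intro n
    have h0 := hn n
    rw [hmte]
    have h1 : (2 * (n : ℝ) + α + β + 2) ≠ 0 := by linarith
    have h2 : (n + α + 1 : ℝ) ≠ 0 := by linarith
    have h3 : 1 - ((n : ℝ) + β + 1) / (2 * (n : ℝ) + α + β + 2)
      = (n + α + 1) / (2 * (n : ℝ) + α + β + 2) := by rw [one_sub_div h1]; congr 1; ring
    rw [h3, div_div_div_cancel_right₀ h1]
  have hro : ∀ n : ℕ, mt (2 * n + 1) / (1 - mt (2 * n + 1))
      = ((n:ℝ) + 1) / (n + α + β + 2) := by
    intro n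
    have h0 := hn n
    rw [hmto]
    have h1 : (2 * (n : ℝ) + α + β + 3) ≠ 0 := by linarith
    have h2 : (n + α + β + 2 : ℝ) ≠ 0 := by linarith
    have h3 : 1 - ((n : ℝ) + 1) / (2 * (n : ℝ) + α + β + 3)
      = (n + α + β + 2) / (2 * (n : ℝ) + α + β + 3) := by rw [one_sub_div h1]; congr 1; ring
    rw [h3, div_div_div_cancel_right₀ h1]
  have hA0 : a 0 = (β + 1) / (α + β + 2) := by
    have h1 : α + β + 1 ≠ 0 := by linarith
    have h2 : α + β + 2 ≠ 0 := by linarith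
    have h3 : 2 + α + β ≠ 0 := by linarith
    simp only [a, Nat.cast_zero]
    rw [div_eq_div_iff (by apply mul_ne_zero <;> linarith) h2]
    ring
  refine ⟨?_, ?_, ?_, ?_, hA0, ?_⟩
  · intro n
    have h0 := hn n
    simp only [c]
    rw [hmte, hmto]
    push_cast
    have h1 : (2 * (n : ℝ) + α + β + 3) ≠ 0 := by linarith
    have h2 : (2 * (n : ℝ) + α + β + 2) ≠ 0 := by linarith
    rw [one_sub_div h2, div_mul_div_comm, div_eq_div_iff
      (by apply mul_ne_zero <;> linarith) (mul_ne_zero h2 h1)]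
    ring
  · intro n
    have h0 := hn n
    simp only [a]
    rw [show 2 * n + 2 = 2 * (n + 1) by ring, hmte, hmto]
    push_cast
    have h1 : (2 * (n : ℝ) + α + β + 3) ≠ 0 := by linarith
    have h2 : (2 * ((n : ℝ) + 1) + α + β + 2) ≠ 0 := by linarith
    rw [one_sub_div h1, div_mul_div_comm, div_eq_div_iff
      (by apply mul_ne_zero <;> linarith) (mul_ne_zero h1 h2)]
    ring
  · set r : ℕ → ℝ := fun k => mt k / (1 - mt k) with hr
    set P : ℕ → ℝ := fun N => ∏ k ∈ Finset.Icc 1 N, r k with hP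
    have hPs : ∀ N, P (N + 1) = P N * r (N + 1) := fun N => by
      simp only [hP]; rw [Finset.prod_Icc_succ_top (by omega)]
    have hP0 : P 0 = 1 := by simp [hP]
    have hrpos : ∀ N, 0 < r N := by
      intro N
      obtain ⟨n, rfl | rfl⟩ := N.even_or_odd'
      · have h0 := hn n
        simp only [hr]; rw [hre]; apply div_pos <;> linarith
      · have h0 := hn n
        simp only [hr]; rw [hro]; apply div_pos <;> linarith
    have hPpos : ∀ N, 0 < P N := fun N => Finset.prod_pos fun k _ => hrpos k
    obtain ⟨t, hte, hto⟩ : ∃ t : ℕ → ℝ, (∀ n : ℕ, t (2 * n) = ((n:ℝ) + 1) / α) ∧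
        (∀ n : ℕ, t (2 * n + 1) = ((n:ℝ) + β + 2) / α) := by
      refine ⟨fun N => if Even N then ((N / 2 : ℕ) + 1 : ℝ) / α
        else (((N / 2 : ℕ) : ℝ) + β + 2) / α, ?_, ?_⟩
      · intro n; simp
      · intro n
        have : (2 * n + 1) / 2 = n := by omega
        simp [this]
    have hrec : ∀ N, t N = r (N + 1) * (1 + t (N + 1)) := by
      intro N
      obtain ⟨n, rfl | rfl⟩ := N.even_or_odd'
      · have h0 := hn n
        simp only [hr]; rw [hro, hte, hto]
        have h2 : (n + α + β + 2 : ℝ) ≠ 0 := by linarith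
        field_simp; ring
      · have h0 := hn n
        simp only [hr]
        rw [show 2 * n + 1 + 1 = 2 * (n + 1) by ring, hre, hte, hto]
        push_cast
        have h2 : ((n:ℝ) + 1 + α + 1 : ℝ) ≠ 0 := by linarith
        field_simp; ring
    have htb : ∀ N : ℕ, 0 < t N ∧ t N ≤ (β + 2) / α * ((N:ℝ) + 1) := by
      intro N
      obtain ⟨n, rfl | rfl⟩ := N.even_or_odd'
      · have h0 := hn n
        rw [hte]
        refine ⟨by positivity, ?_⟩
        rw [div_mul_eq_mul_div]
        gcongr
        push_cast
        nlinarith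
      · have h0 := hn n
        rw [hto]
        refine ⟨div_pos (by linarith) hα, ?_⟩
        rw [div_mul_eq_mul_div]
        gcongr
        push_cast
        nlinarith
    have hsum : ∀ N, ∑ i ∈ Finset.range N, P (i + 1) = 1 / α - P N * t N := by
      intro N
      induction N with
      | zero =>
        have := hte 0
        simp at this
        simp [hP0, this]
      | succ N ih =>
        rw [Finset.sum_range_succ, ih, hrec N, hPs]; ring
    have hS : Summable fun n => P (n + 1) := by
      refine summable_of_sum_range_le (c := 1 / α) (fun n => (hPpos _).le) fun N => ?_
      rw [hsum]
      have := mul_pos (hPpos N) (htb N).1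
      linarith
    have hle : ∀ N, P N * t N ≥ 1 / α - ∑' n, P (n + 1) := by
      intro N
      have := hS.sum_le_tsum (Finset.range N) (fun i _ => (hPpos _).le)
      rw [hsum] at this
      linarith
    have hup : ∑' n, P (n + 1) ≤ 1 / α := by
      refine hS.tsum_le_of_sum_range_le fun N => ?_
      rw [hsum]
      have := mul_pos (hPpos N) (htb N).1
      linarith
    have heq : ∑' n, P (n + 1) = 1 / α := by
      by_contra hne
      have hlt := lt_of_le_of_ne hup hne
      set L := 1 / α - ∑' n, P (n + 1) with hL
      have hLpos : 0 < L := by linarith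
      have hC : 0 < (β + 2) / α := div_pos (by linarith) hα
      have hS0 : Summable P := (summable_nat_add_iff 1).1 hS
      have hb : ∀ N : ℕ, 1 / ((N + 1 : ℕ) : ℝ) ≤ ((β + 2) / α / L) * P N := by
        intro N
        have h1 := hle N
        have h2 := mul_le_mul_of_nonneg_left (htb N).2 (hPpos N).le
        have h0 := hn N
        push_cast
        rw [div_mul_eq_mul_div, div_le_div_iff₀ (by linarith) hLpos]
        nlinarith
      have h3 : Summable fun N : ℕ => 1 / ((N + 1 : ℕ) : ℝ) :=
        Summable.of_nonneg_of_le (fun N => by positivity) hb (hS0.mul_left _)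
      exact Real.not_summable_one_div_natCast
        ((summable_nat_add_iff (f := fun n : ℕ => 1 / (n : ℝ)) 1).1 h3)
    rw [← heq]
    exact hS.hasSum
  · have h := hmte 0
    simp at h
    rw [h]
    have h1 : α + β + 2 ≠ 0 := by linarith
    have h2 : α + 1 ≠ 0 := by linarith
    have h4 : 1 + 1 / α = (α + 1) / α := by field_simp
    rw [h4]
    field_simp
    ring
  · rw [hA0]
    apply div_le_div_of_nonneg_right <;> linarith
end
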